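/- arXiv:0801.0612 — 2 statements merged into one kernel-verified Lean document; each statement's English description precedes it below -/
import Mathlib

section
/- Let d ≥ 2. Given an integer n ≥ 1 and reals t ≥ 0, ε > 0, there exists δ > 0 such that for every Lebesgue-measurable set D ⊂ ℝᵈ×S₁^{d−1} with (vol_{ℝᵈ}×vol_{S₁^{d−1}})(D) ≤ δ, the set {(S₁,…,Sₙ,Ŝ_{n+1}) ∈ ℝⁿᵈ×S₁^{d−1} : Σ_{k=1}^{n}‖Sₖ‖ < t and (Σ_{k=1}^{n}Sₖ + (t−Σ_{k=1}^{n}‖Sₖ‖)Ŝ_{n+1}, Ŝ_{n+1}) ∈ D} has ((vol_{ℝᵈ})ⁿ×vol_{S₁^{d−1}})-measure less than ε. -/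
open MeasureTheory Metric Set Filter
open scoped Topology ENNReal

noncomputable section

/-- Euclidean space `ℝᵈ`. -/
abbrev Vec (d : ℕ) : Type := EuclideanSpace ℝ (Fin d)

/-- The unit sphere `S₁^{d-1} ⊂ ℝᵈ`. -/
def sph (d : ℕ) : Set (Vec d) := Metric.sphere (0 : Vec d) 1

/-- The Lebesgue surface measure on the unit sphere, viewed as a measure on `ℝᵈ`. -/
def sphVol (d : ℕ) : Measure (Vec d) :=
  Measure.map Subtype.val (volume : Measure (Vec d)).toSphere

/-- The reflection-type map `s ↦ s - ‖s‖ v` pulls Lebesgue null sets back to null sets when `v` is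
a unit vector in dimension at least two. -/
lemma quasiMeasurePreserving_sub_norm_smul {d : ℕ} (hd : 2 ≤ d) {v : Vec d} (hv : ‖v‖ = 1) :
    Measure.QuasiMeasurePreserving (fun s : Vec d ↦ s - ‖s‖ • v) volume volume := by
  have hcont : Continuous (fun s : Vec d ↦ s - ‖s‖ • v) := by fun_prop
  refine ⟨hcont.measurable, Measure.AbsolutelyContinuous.mk fun N hN hN0 ↦ ?_⟩
  rw [Measure.map_apply hcont.measurable hN]
  set A : Set (Vec d) := {s | inner ℝ s v < ‖s‖} with hA
  have hAmeas : MeasurableSet A := by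
    have : IsOpen A := isOpen_lt (by fun_prop) (by fun_prop)
    exact this.measurableSet
  have hAc : volume Aᶜ = 0 := by
    have hsub : Aᶜ ⊆ (Submodule.span ℝ {v} : Set (Vec d)) := by
      intro s hs
      have hs' : ‖s‖ ≤ inner ℝ s v := not_lt.1 hs
      have heq : inner ℝ s v = ‖s‖ * ‖v‖ :=
        le_antisymm (real_inner_le_norm s v) (by rw [hv, mul_one]; exact hs')
      rw [inner_eq_norm_mul_iff_real, hv, one_smul] at heq
      rw [heq]
      exact Submodule.smul_mem _ _ (Submodule.mem_span_singleton_self v)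
    refine measure_mono_null hsub (Measure.addHaar_submodule _ _ fun htop ↦ ?_)
    have h1 := finrank_span_singleton (K := ℝ) (v := v) (by rintro rfl; simp at hv)
    rw [htop, finrank_top, finrank_euclideanSpace_fin] at h1
    omega
  have hpos : ∀ s ∈ A, 0 < ‖s‖ := by
    intro s hs
    refine norm_pos_iff.2 ?_
    rintro rfl
    simp [hA] at hs
  have hderiv : ∀ s ∈ A, HasFDerivWithinAt (fun s : Vec d ↦ s - ‖s‖ • v)
      (ContinuousLinearMap.id ℝ (Vec d) - (‖s‖⁻¹ • innerSL ℝ s).smulRight v) A s := by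
    intro s hs
    have hs0 := hpos s hs
    have hn : HasFDerivAt (fun s : Vec d ↦ ‖s‖) (‖s‖⁻¹ • innerSL ℝ s) s := by
      have h := (hasStrictFDerivAt_norm_sq s).hasFDerivAt.sqrt (by positivity)
      simp only [Real.sqrt_sq (norm_nonneg _)] at h
      have hc : (1 / (2 * ‖s‖)) • (2 : ℕ) • innerSL ℝ s = ‖s‖⁻¹ • innerSL ℝ s := by
        rw [← Nat.cast_smul_eq_nsmul ℝ, smul_smul]
        congr 1
        push_cast
        field_simp
      rwa [hc] at h
    exact ((hasFDerivAt_id s).sub (hn.smul_const v)).hasFDerivWithinAt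
  have hinj : InjOn (fun s : Vec d ↦ s - ‖s‖ • v) A := by
    intro s hs s' hs' h
    have h1 : s = s' + (‖s‖ - ‖s'‖) • v := by
      rw [sub_smul]
      have : s - ‖s‖ • v = s' - ‖s'‖ • v := h
      rw [← sub_eq_zero] at this ⊢
      rw [← this]
      abel
    have h2 : ‖s‖ ^ 2 = ‖s'‖ ^ 2 + 2 * ((‖s‖ - ‖s'‖) * inner ℝ s' v) + (‖s‖ - ‖s'‖) ^ 2 := by
      conv_lhs => rw [h1]
      rw [norm_add_sq_real, inner_smul_right, norm_smul, hv, mul_one, Real.norm_eq_abs, sq_abs]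
    have h3 : (‖s‖ - ‖s'‖) * (‖s'‖ - inner ℝ s' v) = 0 := by linarith
    rcases mul_eq_zero.1 h3 with h4 | h4
    · rw [h4, zero_smul, add_zero] at h1
      exact h1
    · have : inner ℝ s' v < ‖s'‖ := hs'
      linarith
  have hdet : ∀ s ∈ A, (ContinuousLinearMap.id ℝ (Vec d) -
      (‖s‖⁻¹ • innerSL ℝ s).smulRight v).det ≠ 0 := by
    intro s hs h0
    have hs0 := hpos s hs
    have hs1 : inner ℝ s v < ‖s‖ := hs
    refine LinearMap.det_eq_zero_iff_ker_ne_bot.1 h0 (LinearMap.ker_eq_bot'.2 fun w hw ↦ ?_)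
    have hw1 : w = (‖s‖⁻¹ * inner ℝ s w) • v := by
      simpa [sub_eq_zero] using hw
    have hw2 : inner ℝ s w = (‖s‖⁻¹ * inner ℝ s w) * inner ℝ s v := by
      conv_lhs => rw [hw1]
      rw [inner_smul_right]
    have hw3 : inner ℝ s w * (‖s‖ - inner ℝ s v) = 0 := by
      field_simp at hw2
      linarith
    rcases mul_eq_zero.1 hw3 with h4 | h4
    · rw [hw1, h4, mul_zero, zero_smul]
    · linarith
  have hcov := lintegral_image_eq_lintegral_abs_det_fderiv_mul volume hAmeas hderiv hinj
    (N.indicator 1)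
  have hzero : ∫⁻ x in (fun s : Vec d ↦ s - ‖s‖ • v) '' A, N.indicator 1 x = 0 := by
    rw [lintegral_indicator_one hN]
    exact le_antisymm ((Measure.restrict_apply_le _ _).trans hN0.le) zero_le
  rw [hzero, eq_comm, lintegral_eq_zero_iff' ?meas, Filter.EventuallyEq,
    ae_restrict_iff' hAmeas] at hcov
  case meas =>
    exact (aemeasurable_ofReal_abs_det_fderivWithin volume hAmeas hderiv).mul
      (((measurable_one.indicator hN).comp hcont.measurable).aemeasurable)
  have hAae : ∀ᵐ s ∂(volume : Measure (Vec d)), s ∈ A := by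
    rw [ae_iff]; exact hAc
  have : ∀ᵐ s ∂(volume : Measure (Vec d)), s ∉ (fun s : Vec d ↦ s - ‖s‖ • v) ⁻¹' N := by
    filter_upwards [hcov, hAae] with s hs hsA hsN
    have h5 := hs hsA
    have hsN' : s - ‖s‖ • v ∈ N := hsN
    simp only [Set.indicator_of_mem hsN', Pi.one_apply, mul_one, Pi.zero_apply,
      ENNReal.ofReal_eq_zero, abs_nonpos_iff] at h5
    exact hdet s hsA h5
  simp only [ae_iff, not_not] at this
  exact this

/-- For a fixed unit final direction `v`, the endpoint of a path with steps `S` and total length `t`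
depends on `S` through a quasi-measure-preserving map. -/
lemma quasiMeasurePreserving_endpoint {d : ℕ} (hd : 2 ≤ d) {n : ℕ} (hn : 1 ≤ n) (t : ℝ)
    {v : Vec d} (hv : ‖v‖ = 1) :
    Measure.QuasiMeasurePreserving
      (fun S : Fin n → Vec d ↦ (∑ k, S k) + (t - ∑ k, ‖S k‖) • v) volume volume := by
  obtain ⟨m, rfl⟩ : ∃ m, n = m + 1 := ⟨n - 1, by omega⟩
  have hg : Measure.QuasiMeasurePreserving
      (fun p : Vec d × (Fin m → Vec d) ↦
        (p.1 - ‖p.1‖ • v) + ((∑ k, p.2 k) + (t - ∑ k, ‖p.2 k‖) • v))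
      (volume.prod volume) volume := by
    refine QuasiMeasurePreserving.prod_of_left ?_ (Eventually.of_forall fun r ↦ ?_)
    · exact Continuous.measurable (by fun_prop)
    · exact (measurePreserving_add_right volume
        ((∑ k, r k) + (t - ∑ k, ‖r k‖) • v)).quasiMeasurePreserving.comp
          (quasiMeasurePreserving_sub_norm_smul hd hv)
  have heq : (fun S : Fin (m + 1) → Vec d ↦ (∑ k, S k) + (t - ∑ k, ‖S k‖) • v) =
      (fun p : Vec d × (Fin m → Vec d) ↦
        (p.1 - ‖p.1‖ • v) + ((∑ k, p.2 k) + (t - ∑ k, ‖p.2 k‖) • v)) ∘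
      MeasurableEquiv.piFinSuccAbove (fun _ : Fin (m + 1) ↦ Vec d) 0 := by
    funext S
    simp only [Function.comp_apply, MeasurableEquiv.piFinSuccAbove_apply,
      Fin.insertNthEquiv_symm_apply, Fin.removeNth_apply, Fin.zero_succAbove, Fin.sum_univ_succ]
    module
  rw [heq]
  exact hg.comp (volume_preserving_piFinSuccAbove
    (fun _ : Fin (m + 1) ↦ Vec d) 0).quasiMeasurePreserving

instance isFiniteMeasure_sphVol (d : ℕ) : IsFiniteMeasure (sphVol d) := by
  unfold sphVol; infer_instance

lemma ae_sphVol_norm_eq_one (d : ℕ) : ∀ᵐ v ∂(sphVol d), ‖v‖ = 1 := by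
  rw [sphVol, ae_map_iff measurable_subtype_coe.aemeasurable
    (measurableSet_eq_fun measurable_norm measurable_const)]
  exact Eventually.of_forall fun x ↦ by simp

/-- The map from steps and final direction to endpoint and final direction is
quasi-measure-preserving. -/
lemma quasiMeasurePreserving_endpoint_prod {d : ℕ} (hd : 2 ≤ d) {n : ℕ} (hn : 1 ≤ n) (t : ℝ) :
    Measure.QuasiMeasurePreserving
      (fun x : (Fin n → Vec d) × Vec d ↦ ((∑ k, x.1 k) + (t - ∑ k, ‖x.1 k‖) • x.2, x.2))
      (volume.prod (sphVol d)) (volume.prod (sphVol d)) := by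
  have hF : Measurable
      (fun x : (Fin n → Vec d) × Vec d ↦ ((∑ k, x.1 k) + (t - ∑ k, ‖x.1 k‖) • x.2, x.2)) :=
    Continuous.measurable (by fun_prop)
  refine ⟨hF, Measure.AbsolutelyContinuous.mk fun D hD hD0 ↦ ?_⟩
  rw [Measure.map_apply hF hD, Measure.prod_apply_symm (hF hD),
    lintegral_eq_zero_iff (measurable_measure_prodMk_right (hF hD))]
  rw [Measure.prod_apply_symm hD, lintegral_eq_zero_iff (measurable_measure_prodMk_right hD)] at hD0
  filter_upwards [hD0, ae_sphVol_norm_eq_one d] with v hDv hv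
  exact (quasiMeasurePreserving_endpoint hd hn t hv).preimage_null hDv

/-- The `ε`-`δ` form of absolute continuity of a finite measure. -/
lemma exists_pos_measure_lt_of_absolutelyContinuous {α : Type*} [MeasurableSpace α]
    {μ ν : Measure α} [IsFiniteMeasure μ] [SigmaFinite ν] (h : μ ≪ ν) {ε : ℝ≥0∞} (hε : ε ≠ 0) :
    ∃ δ > (0 : ℝ), ∀ s, ν s ≤ ENNReal.ofReal δ → μ s < ε := by
  obtain ⟨δ, hδ, H⟩ := exists_pos_setLIntegral_lt_of_measure_lt
    (Measure.lintegral_rnDeriv_lt_top μ ν).ne hε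
  obtain ⟨r, hr0, hrδ⟩ := ENNReal.lt_iff_exists_nnreal_btwn.1 hδ
  refine ⟨r, by exact_mod_cast hr0, fun s hs ↦ ?_⟩
  rw [← Measure.setLIntegral_rnDeriv h]
  exact H s (hs.trans_lt (by simpa using hrδ))

/-- Lemma `NPOSKEYLEMMA` of Marklof–Strömbergsson. -/
theorem statement14 (d : ℕ) (hd : 2 ≤ d) (n : ℕ) (hn : 1 ≤ n) (t : ℝ) (ht : 0 ≤ t)
    (ε : ℝ) (hε : 0 < ε) :
    ∃ δ > (0:ℝ), ∀ D : Set (Vec d × Vec d), MeasurableSet D →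
      ((volume : Measure (Vec d)).prod (sphVol d)) D ≤ ENNReal.ofReal δ →
      ((volume : Measure (Fin n → Vec d)).prod (sphVol d))
        {x : (Fin n → Vec d) × Vec d |
          (∑ k, ‖x.1 k‖) < t ∧
          ((∑ k, x.1 k) + (t - ∑ k, ‖x.1 k‖) • x.2, x.2) ∈ D} < ENNReal.ofReal ε := by
  have hF := quasiMeasurePreserving_endpoint_prod (d := d) hd hn t
  set F := fun x : (Fin n → Vec d) × Vec d ↦ ((∑ k, x.1 k) + (t - ∑ k, ‖x.1 k‖) • x.2, x.2)
  set A : Set ((Fin n → Vec d) × Vec d) := {x | (∑ k, ‖x.1 k‖) < t} with hA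
  have hAfin : ((volume : Measure (Fin n → Vec d)).prod (sphVol d)) A ≠ ∞ := by
    have hsub : A ⊆ closedBall (0 : Fin n → Vec d) t ×ˢ univ := by
      intro x hx
      refine ⟨mem_closedBall_zero_iff.2 ((pi_norm_le_iff_of_nonneg ht).2 fun k ↦ ?_), mem_univ _⟩
      exact (Finset.single_le_sum (f := fun k ↦ ‖x.1 k‖) (fun _ _ ↦ norm_nonneg _)
        (Finset.mem_univ k)).trans (le_of_lt hx)
    refine ((measure_mono hsub).trans_lt ?_).ne
    rw [Measure.prod_prod]
    exact ENNReal.mul_lt_top measure_closedBall_lt_top (measure_lt_top _ _)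
  have : IsFiniteMeasure (((volume : Measure (Fin n → Vec d)).prod (sphVol d)).restrict A) :=
    isFiniteMeasure_restrict.2 hAfin
  have hac : (((volume : Measure (Fin n → Vec d)).prod (sphVol d)).restrict A).map F ≪
      (volume : Measure (Vec d)).prod (sphVol d) :=
    (Measure.absolutelyContinuous_of_le Measure.restrict_le_self).map hF.measurable |>.trans
      hF.absolutelyContinuous
  obtain ⟨δ, hδ, H⟩ := exists_pos_measure_lt_of_absolutelyContinuous hac
    (ENNReal.ofReal_pos.2 hε).ne'
  refine ⟨δ, hδ, fun D hD hDδ ↦ ?_⟩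
  have h := H D hDδ
  rw [Measure.map_apply hF.measurable hD, Measure.restrict_apply (hF.measurable hD),
    inter_comm] at h
  exact h
end
end

section
/- Let d ≥ 2. Given an integer n ≥ 0 and reals t ≥ 0, ε > 0, there exists δ > 0 such that for every Lebesgue-measurable set D ⊂ ℝᵈ×S₁^{d−1} with (vol_{ℝᵈ}×vol_{S₁^{d−1}})(D) ≤ δ, the set {(Q₀,S₁,…,Sₙ,Ŝ_{n+1}) ∈ ℝᵈ×ℝⁿᵈ×S₁^{d−1} : Σ_{k=1}^{n}‖Sₖ‖ ≤ t and (Q₀+Σ_{k=1}^{n}Sₖ + (t−Σ_{k=1}^{n}‖Sₖ‖)Ŝ_{n+1}, Ŝ_{n+1}) ∈ D} has (vol_{ℝᵈ}×(vol_{ℝᵈ})ⁿ×vol_{S₁^{d−1}})-measure less than ε. -/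
open MeasureTheory Metric Set Filter
open scoped Topology ENNReal

noncomputable section

/-- Translation invariance in the first variable: the set of `(q, S, v)` with `∑ k, ‖S k‖ ≤ t` whose
endpoint at time `t` lies in `D` has measure the volume of the admissible `S` times the measure
of `D`. -/
theorem measure_sum_norm_le_and_mem_eq {d n : ℕ} (ν : Measure (Vec d)) [SFinite ν] (t : ℝ)
    {D : Set (Vec d × Vec d)} (hD : MeasurableSet D) :
    ((volume : Measure (Vec d)).prod ((volume : Measure (Fin n → Vec d)).prod ν))
        {x : Vec d × (Fin n → Vec d) × Vec d |
          (∑ k, ‖x.2.1 k‖) ≤ t ∧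
          (x.1 + (∑ k, x.2.1 k) + (t - ∑ k, ‖x.2.1 k‖) • x.2.2, x.2.2) ∈ D} =
      (volume : Measure (Fin n → Vec d)) {S | ∑ k, ‖S k‖ ≤ t} *
        ((volume : Measure (Vec d)).prod ν) D := by
  set A : Set (Fin n → Vec d) := {S | ∑ k, ‖S k‖ ≤ t}
  have hA : MeasurableSet A := measurableSet_le (by fun_prop) measurable_const
  have hE : MeasurableSet {x : Vec d × (Fin n → Vec d) × Vec d |
      (∑ k, ‖x.2.1 k‖) ≤ t ∧
      (x.1 + (∑ k, x.2.1 k) + (t - ∑ k, ‖x.2.1 k‖) • x.2.2, x.2.2) ∈ D} := by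
    have hm : Measurable fun x : Vec d × (Fin n → Vec d) × Vec d =>
        (x.1 + (∑ k, x.2.1 k) + (t - ∑ k, ‖x.2.1 k‖) • x.2.2, x.2.2) := by fun_prop
    exact (hA.preimage (measurable_fst.comp measurable_snd)).inter (hm hD)
  have hslice : ∀ y : (Fin n → Vec d) × Vec d,
      (volume : Measure (Vec d)) ((fun q => (q, y)) ⁻¹' {x : Vec d × (Fin n → Vec d) × Vec d |
        (∑ k, ‖x.2.1 k‖) ≤ t ∧
        (x.1 + (∑ k, x.2.1 k) + (t - ∑ k, ‖x.2.1 k‖) • x.2.2, x.2.2) ∈ D}) =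
      A.indicator 1 y.1 * (volume : Measure (Vec d)) ((fun q => (q, y.2)) ⁻¹' D) := by
    rintro ⟨S, v⟩
    by_cases hS : S ∈ A
    · rw [indicator_of_mem hS, Pi.one_apply, one_mul,
        ← measure_preimage_add_right volume ((∑ k, S k) + (t - ∑ k, ‖S k‖) • v)
          ((fun q => (q, v)) ⁻¹' D)]
      congr 1
      ext q
      simp only [mem_preimage, mem_ofPred_eq, ← add_assoc]
      exact and_iff_right hS
    · rw [indicator_of_notMem hS, zero_mul]
      convert measure_empty (μ := (volume : Measure (Vec d)))
      ext q
      simp only [mem_preimage, mem_ofPred_eq, mem_empty_iff_false, iff_false]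
      exact fun h => hS h.1
  rw [Measure.prod_apply_symm hE, lintegral_congr hslice,
    lintegral_prod_mul (measurable_one.indicator hA).aemeasurable
      (measurable_measure_prodMk_right hD).aemeasurable,
    lintegral_indicator_one hA, Measure.prod_apply_symm hD]

/-- Lemma `NPOSKEYLEMMAMACRO` of Marklof–Strömbergsson. -/
theorem statement16 (d : ℕ) (hd : 2 ≤ d) (n : ℕ) (t : ℝ) (ht : 0 ≤ t)
    (ε : ℝ) (hε : 0 < ε) :
    ∃ δ > (0:ℝ), ∀ D : Set (Vec d × Vec d), MeasurableSet D →
      ((volume : Measure (Vec d)).prod (sphVol d)) D ≤ ENNReal.ofReal δ →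
      ((volume : Measure (Vec d)).prod
          ((volume : Measure (Fin n → Vec d)).prod (sphVol d)))
        {x : Vec d × (Fin n → Vec d) × Vec d |
          (∑ k, ‖x.2.1 k‖) ≤ t ∧
          (x.1 + (∑ k, x.2.1 k) + (t - ∑ k, ‖x.2.1 k‖) • x.2.2, x.2.2) ∈ D} <
        ENNReal.ofReal ε := by
  have hfin : IsFiniteMeasure (sphVol d) := by
    unfold sphVol
    infer_instance
  set A : Set (Fin n → Vec d) := {S | ∑ k, ‖S k‖ ≤ t} with hA
  have hAm : MeasurableSet A := measurableSet_le (by fun_prop) measurable_const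
  have hAfin : (volume : Measure (Fin n → Vec d)) A < ∞ := by
    refine ((Metric.isBounded_closedBall (x := (0 : Fin n → Vec d)) (r := t)).subset
      fun S hS => ?_).measure_lt_top
    rw [mem_closedBall_zero_iff, pi_norm_le_iff_of_nonneg ht]
    exact fun k => (Finset.single_le_sum (f := fun k => ‖S k‖)
      (fun i _ => norm_nonneg _) (Finset.mem_univ k)).trans hS
  obtain ⟨C, hC⟩ : ∃ C : NNReal, (volume : Measure (Fin n → Vec d)) A = C :=
    ⟨_, (ENNReal.coe_toNNReal hAfin.ne).symm⟩
  refine ⟨ε / (C + 1), by positivity, fun D hD hDδ => ?_⟩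
  refine lt_of_le_of_lt (b := C * ENNReal.ofReal (ε / (C + 1))) ?_ ?_
  · rw [← hC]
    refine le_trans (le_of_eq ?_) (mul_le_mul_right hDδ _)
    exact measure_sum_norm_le_and_mem_eq (sphVol d) t hD
  · rw [← ENNReal.ofReal_coe_nnreal, ← ENNReal.ofReal_mul C.coe_nonneg,
      ENNReal.ofReal_lt_ofReal_iff hε, mul_div_assoc', div_lt_iff₀ (by positivity)]
    nlinarith
end
end
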